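/- (Transversality condition at the initial time; specialization of Theorem 4 to the time scale T = ℝ, where ρ(σ(a)) = a holds automatically.) Let x̂ be a weak local extremizer of L with the value x(a) not specified (and x(b) = x_b possibly specified). Then, in addition to the Euler–Lagrange equation, Σ_{i=1}^{m} H_i'(F_1(x̂),…,F_m(x̂)) · f_{iv}(a, x̂(a), x̂'(a)) = 0, where F_i(x̂) = ∫_a^b f_i(t, x̂(t), x̂'(t)) dt. -/

import Mathlib

open Set intervalIntegral

/-- Sup norm of `g` over the interval `[a, b]`. -/
noncomputable def supIcc (a b : ℝ) (g : ℝ → ℝ) : ℝ :=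
  ⨆ t : Icc a b, |g t.1|

open Topology MeasureTheory

/-- A function on `Fin n → ℝ` with continuous partial derivatives is differentiable. -/
theorem hasFDerivAt_of_continuous_partials {n : ℕ} {H : (Fin n → ℝ) → ℝ}
    {H' : Fin n → (Fin n → ℝ) → ℝ}
    (hH : ∀ i z, HasDerivAt (fun s => H (Function.update z i s)) (H' i z) (z i))
    (hH' : ∀ i, Continuous (H' i)) (z : Fin n → ℝ) :
    HasFDerivAt H (∑ i, H' i z • ContinuousLinearMap.proj (R := ℝ) (φ := fun _ : Fin n => ℝ) i)
      z := by
  induction n with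
  | zero => exact hasFDerivAt_of_subsingleton H z
  | succ n ih =>
    have htail : ∀ (s : ℝ) (w : Fin n → ℝ), HasFDerivAt (fun w => H (Fin.cons s w))
        (∑ i : Fin n, H' i.succ (Fin.cons s w) •
          ContinuousLinearMap.proj (R := ℝ) (φ := fun _ : Fin n => ℝ) i) w := by
      intro s w
      refine ih (H := fun w => H (Fin.cons s w)) (H' := fun i w => H' i.succ (Fin.cons s w))
        (fun i w => ?_) (fun i => (hH' i.succ).comp (by fun_prop)) w
      simpa only [Fin.cons_update, Fin.cons_succ] using hH i.succ (Fin.cons s w)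
    have hhead : ∀ (s : ℝ) (w : Fin n → ℝ), HasFDerivAt (fun s => H (Fin.cons s w))
        (ContinuousLinearMap.toSpanSingleton ℝ (H' 0 (Fin.cons s w))) s := by
      intro s w
      simpa only [Fin.update_cons_zero, Fin.cons_zero] using (hH 0 (Fin.cons s w)).hasFDerivAt
    have hprod := (hasStrictFDerivAt_uncurry_coprod (𝕜 := ℝ) (u := (z 0, Fin.tail z))
      (f := fun (s : ℝ) (w : Fin n → ℝ) => H (Fin.cons s w))
      (f₁ := fun s w => ContinuousLinearMap.toSpanSingleton ℝ (H' 0 (Fin.cons s w)))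
      (f₂ := fun s w => ∑ i : Fin n, H' i.succ (Fin.cons s w) •
          ContinuousLinearMap.proj (R := ℝ) (φ := fun _ : Fin n => ℝ) i)
      (.of_forall fun v => hhead v.1 v.2) (.of_forall fun v => htail v.1 v.2)
      (by
        have : Continuous fun v : ℝ × (Fin n → ℝ) => H' 0 (Fin.cons v.1 v.2) :=
          (hH' 0).comp (by fun_prop)
        exact ((ContinuousLinearMap.toSpanSingletonCLE (𝕜 := ℝ) (E := ℝ)).continuous.comp
          this).continuousAt)
      (by
        have : ∀ i : Fin n, Continuous fun v : ℝ × (Fin n → ℝ) =>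
            H' i.succ (Fin.cons v.1 v.2) := fun i => (hH' i.succ).comp (by fun_prop)
        have hsum : Continuous fun v : ℝ × (Fin n → ℝ) => ∑ i : Fin n,
            H' i.succ (Fin.cons v.1 v.2) •
              ContinuousLinearMap.proj (R := ℝ) (φ := fun _ : Fin n => ℝ) i :=
          continuous_finsetSum _ fun i _ => (this i).smul continuous_const
        exact hsum.continuousAt)).hasFDerivAt
    have hsplit : HasFDerivAt (fun z : Fin (n + 1) → ℝ => (z 0, Fin.tail z))
        ((ContinuousLinearMap.proj (R := ℝ) (φ := fun _ : Fin (n + 1) => ℝ) 0).prod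
          (ContinuousLinearMap.pi fun i : Fin n =>
            ContinuousLinearMap.proj (R := ℝ) (φ := fun _ : Fin (n + 1) => ℝ) i.succ)) z :=
      ((ContinuousLinearMap.proj (R := ℝ) (φ := fun _ : Fin (n + 1) => ℝ) 0).prod
          (ContinuousLinearMap.pi fun i : Fin n =>
            ContinuousLinearMap.proj (R := ℝ) (φ := fun _ : Fin (n + 1) => ℝ) i.succ)).hasFDerivAt
    have hcomp := hprod.comp z hsplit
    refine (hcomp.congr_fderiv ?_).congr_of_eventuallyEq (.of_forall fun v => ?_)
    · ext v
      simp [Function.HasUncurry.uncurry, Fin.sum_univ_succ, Fin.cons_self_tail, mul_comm]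
    · simp [Function.HasUncurry.uncurry, Fin.cons_self_tail]

/-- The chain rule along a line for a function of two real variables with continuous partial
derivatives. -/
theorem hasDerivAt_comp_line_of_continuous_partials {g gy gv : ℝ → ℝ → ℝ}
    (hy : ∀ y v, HasDerivAt (fun y' => g y' v) (gy y v) y)
    (hv : ∀ y v, HasDerivAt (fun v' => g y v') (gv y v) v)
    (hyc : Continuous fun p : ℝ × ℝ => gy p.1 p.2)
    (hvc : Continuous fun p : ℝ × ℝ => gv p.1 p.2) (y v η w ε : ℝ) :
    HasDerivAt (fun ε => g (y + ε * η) (v + ε * w))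
      (gy (y + ε * η) (v + ε * w) * η + gv (y + ε * η) (v + ε * w) * w) ε := by
  have hg := (hasStrictFDerivAt_uncurry_coprod (𝕜 := ℝ) (u := (y + ε * η, v + ε * w)) (f := g)
    (f₁ := fun y v => ContinuousLinearMap.toSpanSingleton ℝ (gy y v))
    (f₂ := fun y v => ContinuousLinearMap.toSpanSingleton ℝ (gv y v))
    (.of_forall fun p => (hy p.1 p.2).hasFDerivAt) (.of_forall fun p => (hv p.1 p.2).hasFDerivAt)
    ((ContinuousLinearMap.toSpanSingletonCLE (𝕜 := ℝ) (E := ℝ)).continuous.comp hyc).continuousAt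
    ((ContinuousLinearMap.toSpanSingletonCLE (𝕜 := ℝ) (E := ℝ)).continuous.comp
      hvc).continuousAt).hasFDerivAt
  have hline : HasDerivAt (fun ε : ℝ => (y + ε * η, v + ε * w)) (η, w) ε := by
    have h1 : ∀ c d : ℝ, HasDerivAt (fun ε : ℝ => c + ε * d) d ε := fun c d => by
      simpa using ((hasDerivAt_id ε).mul_const d).const_add c
    exact (h1 y η).prodMk (h1 v w)
  refine (hg.comp_hasDerivAt ε hline).congr_deriv ?_
  simp [Function.HasUncurry.uncurry, mul_comm]

/-- The first variation of an integral functional whose integrand has continuous partial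
derivatives. -/
theorem hasDerivAt_integral_variation {a b : ℝ} (hab : a ≤ b) {f fy fv : ℝ → ℝ → ℝ → ℝ}
    (hf : ContinuousOn (fun p : ℝ × ℝ × ℝ => f p.1 p.2.1 p.2.2)
      (Icc a b ×ˢ (univ : Set (ℝ × ℝ))))
    (hfy : ∀ t ∈ Icc a b, ∀ y v : ℝ, HasDerivAt (fun y' => f t y' v) (fy t y v) y)
    (hfv : ∀ t ∈ Icc a b, ∀ y v : ℝ, HasDerivAt (fun v' => f t y v') (fv t y v) v)
    (hfyc : ContinuousOn (fun p : ℝ × ℝ × ℝ => fy p.1 p.2.1 p.2.2)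
      (Icc a b ×ˢ (univ : Set (ℝ × ℝ))))
    (hfvc : ContinuousOn (fun p : ℝ × ℝ × ℝ => fv p.1 p.2.1 p.2.2)
      (Icc a b ×ˢ (univ : Set (ℝ × ℝ))))
    {x x' η w : ℝ → ℝ} (hx : ContinuousOn x (Icc a b)) (hx' : ContinuousOn x' (Icc a b))
    (hη : ContinuousOn η (Icc a b)) (hw : ContinuousOn w (Icc a b)) :
    HasDerivAt (fun ε => ∫ t in a..b, f t (x t + ε * η t) (x' t + ε * w t))
      (∫ t in a..b, (fy t (x t) (x' t) * η t + fv t (x t) (x' t) * w t)) 0 := by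
  have hsnd : MapsTo Prod.snd ((univ : Set ℝ) ×ˢ Icc a b) (Icc a b) := fun p hp => hp.2
  have hline : ContinuousOn (fun p : ℝ × ℝ =>
      ((p.2, x p.2 + p.1 * η p.2, x' p.2 + p.1 * w p.2) : ℝ × ℝ × ℝ))
      (univ ×ˢ Icc a b) := by
    have hlift : ∀ {g : ℝ → ℝ}, ContinuousOn g (Icc a b) →
        ContinuousOn (fun p : ℝ × ℝ => g p.2) (univ ×ˢ Icc a b) :=
      fun hg => hg.comp continuousOn_snd hsnd
    exact continuousOn_snd.prodMk (((hlift hx).add (continuousOn_fst.mul (hlift hη))).prodMk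
      ((hlift hx').add (continuousOn_fst.mul (hlift hw))))
  have hmaps : MapsTo (fun p : ℝ × ℝ =>
      ((p.2, x p.2 + p.1 * η p.2, x' p.2 + p.1 * w p.2) : ℝ × ℝ × ℝ))
      (univ ×ˢ Icc a b) (Icc a b ×ˢ univ) := fun p hp => ⟨hp.2, mem_univ _⟩
  have hF := hf.comp hline hmaps
  have hF' := ((hfyc.comp hline hmaps).mul (hη.comp continuousOn_snd hsnd)).add
    ((hfvc.comp hline hmaps).mul (hw.comp continuousOn_snd hsnd))
  obtain ⟨C, hC⟩ := ((isCompact_Icc (a := (-1 : ℝ)) (b := 1)).prod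
    (isCompact_Icc (a := a) (b := b))).exists_bound_of_continuousOn
      (hF'.mono (prod_mono (subset_univ _) subset_rfl))
  have hslice : ∀ ε : ℝ, ContinuousOn (fun t : ℝ => (ε, t)) (Icc a b) := fun ε => by fun_prop
  have hslice_maps : ∀ ε : ℝ, MapsTo (fun t : ℝ => (ε, t)) (Icc a b) (univ ×ˢ Icc a b) :=
    fun ε t ht => ⟨mem_univ _, ht⟩
  have hFint := fun ε =>
    ((hF.comp (hslice ε) (hslice_maps ε)).intervalIntegrable_of_Icc (μ := volume) hab)
  have hF'int := ((hF'.comp (hslice 0) (hslice_maps 0)).intervalIntegrable_of_Icc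
    (μ := volume) hab)
  have hIcc : ∀ t ∈ uIoc a b, t ∈ Icc a b := fun t ht => by
    rw [uIoc_of_le hab] at ht
    exact Ioc_subset_Icc_self ht
  have hsection : ∀ {g : ℝ → ℝ → ℝ → ℝ}, ContinuousOn (fun p : ℝ × ℝ × ℝ => g p.1 p.2.1 p.2.2)
      (Icc a b ×ˢ (univ : Set (ℝ × ℝ))) → ∀ t ∈ Icc a b,
      Continuous fun p : ℝ × ℝ => g t p.1 p.2 := fun hg t ht =>
    hg.comp_continuous (f := fun p : ℝ × ℝ => (t, p)) (by fun_prop) fun p => ⟨ht, mem_univ _⟩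
  have key := intervalIntegral.hasDerivAt_integral_of_dominated_loc_of_deriv_le (μ := volume)
    (a := a) (b := b) (x₀ := (0 : ℝ)) (s := Icc (-1 : ℝ) 1) (bound := fun _ => C)
    (F := fun ε t => f t (x t + ε * η t) (x' t + ε * w t))
    (F' := fun ε t => fy t (x t + ε * η t) (x' t + ε * w t) * η t +
      fv t (x t + ε * η t) (x' t + ε * w t) * w t)
    (Icc_mem_nhds (by norm_num) (by norm_num))
    (.of_forall fun ε => (hFint ε).def'.aestronglyMeasurable) (hFint 0)
    hF'int.def'.aestronglyMeasurable
    (.of_forall fun t ht ε hε => hC (ε, t) ⟨hε, hIcc t ht⟩) intervalIntegrable_const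
    (.of_forall fun t ht ε _ => hasDerivAt_comp_line_of_continuous_partials
      (hfy t (hIcc t ht)) (hfv t (hIcc t ht)) (hsection hfyc t (hIcc t ht))
      (hsection hfvc t (hIcc t ht)) (x t) (x' t) (η t) (w t) ε)
  simpa using key.2

/-- The sup norm of `ε • η` is at most `|ε|` times any bound of `|η|`. -/
theorem supIcc_const_mul_le {a b : ℝ} (hab : a ≤ b) {η : ℝ → ℝ} {C : ℝ}
    (hC : ∀ t ∈ Icc a b, |η t| ≤ C) (ε : ℝ) : supIcc a b (fun t => ε * η t) ≤ |ε| * C := by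
  have : Nonempty (Icc a b) := ⟨⟨a, left_mem_Icc.2 hab⟩⟩
  refine ciSup_le fun t => ?_
  rw [abs_mul]
  exact mul_le_mul_of_nonneg_left (hC t t.2) (abs_nonneg ε)

/-- Du Bois-Reymond lemma with a free initial value: if `∫ A η + B η' = 0` for every `C¹` function
`η` with `η b = 0`, then `B` is the primitive of `A` vanishing at `a`. -/
theorem eq_integral_of_forall_variation_eq_zero {a b : ℝ} (hab : a < b) {A B : ℝ → ℝ}
    (hA : ContinuousOn A (Icc a b)) (hB : ContinuousOn B (Icc a b))
    (h : ∀ η w : ℝ → ℝ, Continuous w → (∀ t, HasDerivAt η (w t) t) → η b = 0 →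
      ∫ t in a..b, (A t * η t + B t * w t) = 0) :
    ∀ t ∈ Icc a b, B t = ∫ τ in a..t, A τ := by
  set Ae : ℝ → ℝ := IccExtend hab.le ((Icc a b).domRestrict A)
  set Be : ℝ → ℝ := IccExtend hab.le ((Icc a b).domRestrict B)
  have hAec : Continuous Ae := (continuousOn_iff_continuous_domRestrict.1 hA).Icc_extend'
  have hBec : Continuous Be := (continuousOn_iff_continuous_domRestrict.1 hB).Icc_extend'
  have hAeq : ∀ t ∈ Icc a b, Ae t = A t := fun t ht => IccExtend_of_mem hab.le _ ht
  have hBeq : ∀ t ∈ Icc a b, Be t = B t := fun t ht => IccExtend_of_mem hab.le _ ht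
  set G : ℝ → ℝ := fun t => ∫ τ in a..t, Ae τ
  have hG : ∀ t, HasDerivAt G (Ae t) t := fun t =>
    intervalIntegral.integral_hasDerivAt_right (hAec.intervalIntegrable _ _)
      (hAec.stronglyMeasurableAtFilter _ _) hAec.continuousAt
  have hGc : Continuous G := continuous_iff_continuousAt.2 fun t => (hG t).continuousAt
  set w : ℝ → ℝ := fun t => Be t - G t with hw
  have hwc : Continuous w := hBec.sub hGc
  set η : ℝ → ℝ := fun t => ∫ τ in b..t, w τ
  have hη : ∀ t, HasDerivAt η (w t) t := fun t =>
    intervalIntegral.integral_hasDerivAt_right (hwc.intervalIntegrable _ _)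
      (hwc.stronglyMeasurableAtFilter _ _) hwc.continuousAt
  have hηc : Continuous η := continuous_iff_continuousAt.2 fun t => (hη t).continuousAt
  have hηb : η b = 0 := intervalIntegral.integral_same
  have hGa : G a = 0 := intervalIntegral.integral_same
  have hzero : ∫ t in a..b, (Ae t * η t + Be t * w t) = 0 := by
    rw [← h η w hwc hη hηb]
    refine intervalIntegral.integral_congr fun t ht => ?_
    rw [uIcc_of_le hab.le] at ht
    simp only [hAeq t ht, hBeq t ht]
  have hparts : ∫ t in a..b, (Ae t * η t + G t * w t) = 0 := by
    rw [intervalIntegral.integral_eq_sub_of_hasDerivAt (f := fun t => G t * η t)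
      (fun t _ => (hG t).mul (hη t))
      ((hAec.mul hηc).add (hGc.mul hwc) |>.intervalIntegrable _ _)]
    simp [hηb, hGa]
  have hsq : ∫ t in a..b, w t ^ 2 = 0 := by
    have hsub := intervalIntegral.integral_sub (μ := volume)
      (((hAec.mul hηc).add (hBec.mul hwc)).intervalIntegrable a b)
      (((hAec.mul hηc).add (hGc.mul hwc)).intervalIntegrable a b)
    simp only [Pi.add_apply, Pi.mul_apply] at hsub
    rw [hzero, hparts, sub_zero] at hsub
    rw [← hsub]
    refine intervalIntegral.integral_congr fun t _ => ?_
    simp only [hw]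
    ring
  intro t ht
  have hwt : w t = 0 := by
    by_contra hne
    refine (intervalIntegral.integral_pos hab (hwc.pow 2).continuousOn
      (fun s _ => sq_nonneg (w s)) ⟨t, ht, sq_pos_iff.2 hne⟩).ne' hsq
  rw [← hBeq t ht, sub_eq_zero.1 hwt]
  refine intervalIntegral.integral_congr fun s hs => ?_
  rw [uIcc_of_le ht.1] at hs
  exact hAeq s ⟨hs.1, hs.2.trans ht.2⟩

/-- Transversality condition at the initial time `t = a`
(specialization of Theorem 4 to the time scale `T = ℝ`):
if `xh` is a weak local extremizer with `x(a)` not specified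
(and `x(b) = xb` specified), then the Euler–Lagrange equation holds together with
`∑ i, H'_i · f_{iv}(a, xh(a), xh'(a)) = 0`. -/
theorem transversality_initial_time
    (a b : ℝ) (hab : a < b) (m : ℕ) (hm : 1 ≤ m) (xb : ℝ)
    (f fy fv : Fin m → ℝ → ℝ → ℝ → ℝ)
    (H : (Fin m → ℝ) → ℝ) (H' : Fin m → (Fin m → ℝ) → ℝ)
    (hf : ∀ i, ContinuousOn (fun p : ℝ × ℝ × ℝ => f i p.1 p.2.1 p.2.2)
      (Icc a b ×ˢ (univ : Set (ℝ × ℝ))))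
    (hfy : ∀ i, ∀ t ∈ Icc a b, ∀ y v : ℝ,
      HasDerivAt (fun y' => f i t y' v) (fy i t y v) y)
    (hfv : ∀ i, ∀ t ∈ Icc a b, ∀ y v : ℝ,
      HasDerivAt (fun v' => f i t y v') (fv i t y v) v)
    (hfyc : ∀ i, ContinuousOn (fun p : ℝ × ℝ × ℝ => fy i p.1 p.2.1 p.2.2)
      (Icc a b ×ˢ (univ : Set (ℝ × ℝ))))
    (hfvc : ∀ i, ContinuousOn (fun p : ℝ × ℝ × ℝ => fv i p.1 p.2.1 p.2.2)
      (Icc a b ×ˢ (univ : Set (ℝ × ℝ))))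
    (hH : ∀ i z, HasDerivAt (fun s => H (Function.update z i s)) (H' i z) (z i))
    (hH' : ∀ i, Continuous (H' i))
    (xh xh' : ℝ → ℝ)
    (hxh : ∀ t ∈ Icc a b, HasDerivAt xh (xh' t) t)
    (hxhc : ContinuousOn xh' (Icc a b))
    (hxb : xh b = xb)
    (hext : ∃ δ > (0:ℝ),
      (∀ x x' : ℝ → ℝ,
        (∀ t ∈ Icc a b, HasDerivAt x (x' t) t) → ContinuousOn x' (Icc a b) →
        x b = xb →
        supIcc a b (fun t => x t - xh t) + supIcc a b (fun t => x' t - xh' t) < δ →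
        H (fun i => ∫ t in a..b, f i t (xh t) (xh' t))
          ≤ H (fun i => ∫ t in a..b, f i t (x t) (x' t))) ∨
      (∀ x x' : ℝ → ℝ,
        (∀ t ∈ Icc a b, HasDerivAt x (x' t) t) → ContinuousOn x' (Icc a b) →
        x b = xb →
        supIcc a b (fun t => x t - xh t) + supIcc a b (fun t => x' t - xh' t) < δ →
        H (fun i => ∫ t in a..b, f i t (x t) (x' t))
          ≤ H (fun i => ∫ t in a..b, f i t (xh t) (xh' t)))) :
    (∃ c : ℝ, ∀ t ∈ Icc a b,
      ∑ i : Fin m, H' i (fun j => ∫ s in a..b, f j s (xh s) (xh' s)) *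
        (fv i t (xh t) (xh' t) - ∫ τ in a..t, fy i τ (xh τ) (xh' τ)) = c) ∧
    ∑ i : Fin m, H' i (fun j => ∫ s in a..b, f j s (xh s) (xh' s)) *
      fv i a (xh a) (xh' a) = 0 := by
  set z : Fin m → ℝ := fun j => ∫ s in a..b, f j s (xh s) (xh' s) with hz
  have hxc : ContinuousOn xh (Icc a b) := fun t ht => (hxh t ht).continuousAt.continuousWithinAt
  have hpath : ContinuousOn (fun t => ((t, xh t, xh' t) : ℝ × ℝ × ℝ)) (Icc a b) :=
    continuousOn_id.prodMk (hxc.prodMk hxhc)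
  have hpath_maps : MapsTo (fun t => ((t, xh t, xh' t) : ℝ × ℝ × ℝ)) (Icc a b)
      (Icc a b ×ˢ univ) := fun t ht => ⟨ht, mem_univ _⟩
  have hyc : ∀ i, ContinuousOn (fun t => fy i t (xh t) (xh' t)) (Icc a b) := fun i =>
    (hfyc i).comp hpath hpath_maps
  have hvc : ∀ i, ContinuousOn (fun t => fv i t (xh t) (xh' t)) (Icc a b) := fun i =>
    (hfvc i).comp hpath hpath_maps
  have hEL : ∀ t ∈ Icc a b, ∑ i, H' i z * fv i t (xh t) (xh' t) =
      ∫ τ in a..t, ∑ i, H' i z * fy i τ (xh τ) (xh' τ) := by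
    refine eq_integral_of_forall_variation_eq_zero hab
      (continuousOn_finsetSum _ fun i _ => continuousOn_const.mul (hyc i))
      (continuousOn_finsetSum _ fun i _ => continuousOn_const.mul (hvc i)) fun η w hw hη hηb => ?_
    have hηc : Continuous η := continuous_iff_continuousAt.2 fun t => (hη t).continuousAt
    have hint : HasDerivAt
        (fun (ε : ℝ) (i : Fin m) => ∫ t in a..b, f i t (xh t + ε * η t) (xh' t + ε * w t))
        (fun i => ∫ t in a..b,
          (fy i t (xh t) (xh' t) * η t + fv i t (xh t) (xh' t) * w t)) 0 :=
      hasDerivAt_pi.2 fun i => hasDerivAt_integral_variation hab.le (hf i) (hfy i) (hfv i)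
        (hfyc i) (hfvc i) hxc hxhc hηc.continuousOn hw.continuousOn
    have hderiv := (hasFDerivAt_of_continuous_partials hH hH' z).comp_hasDerivAt_of_eq 0 hint
      (by simp [hz])
    have hextr : IsLocalExtr (H ∘ fun (ε : ℝ) (i : Fin m) =>
        ∫ t in a..b, f i t (xh t + ε * η t) (xh' t + ε * w t)) 0 := by
      obtain ⟨C, hC⟩ := isCompact_Icc.exists_bound_of_continuousOn (s := Icc a b)
        hηc.continuousOn
      obtain ⟨D, hD⟩ := isCompact_Icc.exists_bound_of_continuousOn (s := Icc a b)
        hw.continuousOn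
      obtain ⟨δ, hδ, hmin⟩ := hext
      have hsmall : ∀ᶠ ε : ℝ in 𝓝 0, |ε| * C + |ε| * D < δ := by
        have : Continuous fun ε : ℝ => |ε| * C + |ε| * D := by fun_prop
        exact this.continuousAt.eventually_lt_const (by simpa using hδ)
      have hnorm : ∀ ε : ℝ, |ε| * C + |ε| * D < δ →
          supIcc a b (fun t => xh t + ε * η t - xh t) +
            supIcc a b (fun t => xh' t + ε * w t - xh' t) < δ := fun ε hε => by
        simp only [add_sub_cancel_left]
        exact (add_le_add (supIcc_const_mul_le hab.le hC ε)
          (supIcc_const_mul_le hab.le hD ε)).trans_lt hε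
      have hadm : ∀ ε : ℝ, ∀ t ∈ Icc a b,
          HasDerivAt (fun t => xh t + ε * η t) (xh' t + ε * w t) t := fun ε t ht =>
        (hxh t ht).add ((hη t).const_mul ε)
      have hadmc : ∀ ε : ℝ, ContinuousOn (fun t => xh' t + ε * w t) (Icc a b) := fun ε =>
        hxhc.add (continuousOn_const.mul hw.continuousOn)
      refine hmin.imp (fun h => ?_) (fun h => ?_)
      all_goals
        filter_upwards [hsmall] with ε hε
        simpa using h _ _ (hadm ε) (hadmc ε) (by simp [hxb, hηb]) (hnorm ε hε)
    have hzero := hextr.hasDerivAt_eq_zero hderiv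
    have hint' : ∀ i, IntervalIntegrable (fun t => H' i z *
        (fy i t (xh t) (xh' t) * η t + fv i t (xh t) (xh' t) * w t)) volume a b := fun i =>
      ((((hyc i).mul hηc.continuousOn).add ((hvc i).mul hw.continuousOn)).const_smul
        (H' i z)).intervalIntegrable_of_Icc hab.le
    calc ∫ t in a..b, ((∑ i, H' i z * fy i t (xh t) (xh' t)) * η t +
          (∑ i, H' i z * fv i t (xh t) (xh' t)) * w t)
        = ∫ t in a..b, ∑ i, H' i z *
            (fy i t (xh t) (xh' t) * η t + fv i t (xh t) (xh' t) * w t) := by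
          refine intervalIntegral.integral_congr fun t _ => ?_
          simp only [Finset.sum_mul, ← Finset.sum_add_distrib]
          exact Finset.sum_congr rfl fun i _ => by ring
      _ = 0 := by
          rw [intervalIntegral.integral_finsetSum fun i _ => hint' i]
          simpa [intervalIntegral.integral_const_mul] using hzero
  refine ⟨⟨0, fun t ht => ?_⟩, by simpa using hEL a (left_mem_Icc.2 hab.le)⟩
  have hyint : ∀ i, IntervalIntegrable (fun τ => H' i z * fy i τ (xh τ) (xh' τ)) volume a t :=
    fun i => ((continuousOn_const.mul (hyc i)).mono
      (Icc_subset_Icc_right ht.2)).intervalIntegrable_of_Icc ht.1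
  have hELt := hEL t ht
  rw [intervalIntegral.integral_finsetSum fun i _ => hyint i] at hELt
  simp only [intervalIntegral.integral_const_mul] at hELt
  simp only [mul_sub, Finset.sum_sub_distrib, hELt, sub_self]
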